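/- For positive integers m ≥ n, the complete bipartite graph K_{m,n} is NIC-planar if and only if n ≤ 2, or n = 3 and m ≤ 4. -/

import Mathlib

open Set

/-- Two subsets of the plane *properly cross* at a point `p`: in some open
neighbourhood of `p` the pair of sets looks, up to homeomorphism, like the two
coordinate axes meeting at the origin. -/
def ProperCross (A₁ A₂ : Set (ℝ × ℝ)) (p : ℝ × ℝ) : Prop :=
  ∃ U : Set (ℝ × ℝ), IsOpen U ∧ ∃ hp : p ∈ U, ∃ φ : U ≃ₜ (ℝ × ℝ),
    φ ⟨p, hp⟩ = (0, 0) ∧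
    (fun x => φ x) '' {x : U | (x : ℝ × ℝ) ∈ A₁} = {q : ℝ × ℝ | q.2 = 0} ∧
    (fun x => φ x) '' {x : U | (x : ℝ × ℝ) ∈ A₂} = {q : ℝ × ℝ | q.1 = 0}

/-- A drawing of a simple graph `G` in the plane: vertices go to distinct points,
each edge is drawn as a continuous injective arc joining the points of its two
endpoints, no arc passes through the point of a vertex other than its endpoints,
arcs of edges sharing an endpoint meet only at that common point, any two arcs
meet in finitely many points, every intersection point of two arcs that is not a
common endpoint is a proper crossing, and no point of the plane that is not a
vertex point lies on more than two arcs. -/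
structure Drawing {V : Type*} (G : SimpleGraph V) where
  pos : V → ℝ × ℝ
  pos_inj : Function.Injective pos
  arc : G.edgeSet → ℝ → ℝ × ℝ
  arc_cont : ∀ e, ContinuousOn (arc e) (Icc 0 1)
  arc_inj : ∀ e, InjOn (arc e) (Icc 0 1)
  arc_ends : ∀ e : G.edgeSet, ∃ u v : V, (e : Sym2 V) = s(u, v) ∧
    arc e 0 = pos u ∧ arc e 1 = pos v
  no_vertex_interior : ∀ (e : G.edgeSet) (v : V), v ∉ (e : Sym2 V) →
    pos v ∉ arc e '' Icc 0 1
  shared_endpoint : ∀ e₁ e₂ : G.edgeSet, e₁ ≠ e₂ → ∀ v : V,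
    v ∈ (e₁ : Sym2 V) → v ∈ (e₂ : Sym2 V) →
    arc e₁ '' Icc 0 1 ∩ arc e₂ '' Icc 0 1 ⊆ {pos v}
  finite_meet : ∀ e₁ e₂ : G.edgeSet, e₁ ≠ e₂ →
    (arc e₁ '' Icc 0 1 ∩ arc e₂ '' Icc 0 1).Finite
  proper : ∀ e₁ e₂ : G.edgeSet, e₁ ≠ e₂ →
    ∀ p ∈ arc e₁ '' Icc 0 1 ∩ arc e₂ '' Icc 0 1, p ∉ Set.range pos →
    ProperCross (arc e₁ '' Icc 0 1) (arc e₂ '' Icc 0 1) p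
  at_most_two : ∀ p : ℝ × ℝ, p ∉ Set.range pos →
    ∀ e₁ e₂ e₃ : G.edgeSet, p ∈ arc e₁ '' Icc 0 1 → p ∈ arc e₂ '' Icc 0 1 →
      p ∈ arc e₃ '' Icc 0 1 → e₁ = e₂ ∨ e₁ = e₃ ∨ e₂ = e₃

namespace Drawing

variable {V : Type*} {G : SimpleGraph V}

/-- The image of the arc drawn for the edge `e`. -/
def arcIm (D : Drawing G) (e : G.edgeSet) : Set (ℝ × ℝ) :=
  D.arc e '' Icc 0 1

/-- The set of crossings of the drawing: points that are not vertex points and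
lie on (at least, hence exactly) two arcs.  (An intersection point of two arcs
that is a common endpoint of the two edges is a vertex point, and conversely a
vertex point on two arcs is a common endpoint, so these are precisely the
intersection points of pairs of arcs that are not common endpoints.) -/
def crossings (D : Drawing G) : Set (ℝ × ℝ) :=
  {p | p ∉ Set.range D.pos ∧ ∃ e₁ e₂ : G.edgeSet, e₁ ≠ e₂ ∧ p ∈ D.arcIm e₁ ∧ p ∈ D.arcIm e₂}

/-- The number of crossings of the drawing. -/
noncomputable def crossingCount (D : Drawing G) : ℕ := D.crossings.ncard

/-- The cluster set `S(c)` of a crossing `c`: the set of end-vertices of the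
(two) edges whose arcs pass through `c`. -/
def cluster (D : Drawing G) (c : ℝ × ℝ) : Set V :=
  {v | ∃ e : G.edgeSet, c ∈ D.arcIm e ∧ v ∈ (e : Sym2 V)}

/-- A drawing is 1-planar if each edge's arc is crossed at most once. -/
def IsOnePlanar (D : Drawing G) : Prop :=
  ∀ e : G.edgeSet, {p | p ∈ D.crossings ∧ p ∈ D.arcIm e}.Subsingleton

/-- A drawing is NIC-planar if it is 1-planar and the cluster sets of any two
distinct crossings share at most one vertex. -/
def IsNICPlanar (D : Drawing G) : Prop :=
  D.IsOnePlanar ∧ ∀ c₁ ∈ D.crossings, ∀ c₂ ∈ D.crossings, c₁ ≠ c₂ →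
    (D.cluster c₁ ∩ D.cluster c₂).ncard ≤ 1

/-- A drawing is IC-planar if it is 1-planar and the cluster sets of any two
distinct crossings are disjoint. -/
def IsICPlanar (D : Drawing G) : Prop :=
  D.IsOnePlanar ∧ ∀ c₁ ∈ D.crossings, ∀ c₂ ∈ D.crossings, c₁ ≠ c₂ →
    D.cluster c₁ ∩ D.cluster c₂ = ∅

end Drawing

/-- A graph is 1-planar if it admits a 1-planar drawing. -/
def SimpleGraph.OnePlanar {V : Type*} (G : SimpleGraph V) : Prop :=
  ∃ D : Drawing G, D.IsOnePlanar

/-- A graph is NIC-planar if it admits an NIC-planar drawing. -/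
def SimpleGraph.NICPlanar {V : Type*} (G : SimpleGraph V) : Prop :=
  ∃ D : Drawing G, D.IsNICPlanar

/-- A graph is IC-planar if it admits an IC-planar drawing. -/
def SimpleGraph.ICPlanar {V : Type*} (G : SimpleGraph V) : Prop :=
  ∃ D : Drawing G, D.IsICPlanar

/-- The crossing number of `G`: the minimum number of crossings over all
drawings of `G`. -/
noncomputable def SimpleGraph.crossingNumber {V : Type*} (G : SimpleGraph V) : ℕ :=
  sInf {n | ∃ D : Drawing G, D.crossingCount = n}
/-- The graph `H` is a minimum non-NIC-planar graph: `H` is not NIC-planar but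
deleting any single edge of `H` yields an NIC-planar graph. -/
def MinNonNICPlanar {V : Type*} (H : SimpleGraph V) : Prop :=
  ¬ H.NICPlanar ∧ ∀ e ∈ H.edgeSet, (H.deleteEdges {e}).NICPlanar

/-- The graph `H` is a minimum non-IC-planar graph: `H` is not IC-planar but
deleting any single edge of `H` yields an IC-planar graph. -/
def MinNonICPlanar {V : Type*} (H : SimpleGraph V) : Prop :=
  ¬ H.ICPlanar ∧ ∀ e ∈ H.edgeSet, (H.deleteEdges {e}).ICPlanar

/-- The complete multipartite graph with parts of sizes `a 0, …, a (k-1)`. -/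
abbrev completeMultipartite {k : ℕ} (a : Fin k → ℕ) :
    SimpleGraph (Σ i : Fin k, Fin (a i)) :=
  SimpleGraph.completeMultipartiteGraph fun i => Fin (a i)

/-- `G` contains a subgraph isomorphic to `H`, i.e. there is an injective graph
homomorphism from `H` to `G`. -/
def ContainsSubgraphIso {V W : Type*} (G : SimpleGraph V) (H : SimpleGraph W) : Prop :=
  ∃ f : H →g G, Function.Injective f
lemma properCross_of_homeomorph {A₁ A₂ : Set (ℝ × ℝ)} {p : ℝ × ℝ} (ψ : (ℝ × ℝ) ≃ₜ (ℝ × ℝ))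
    (h0 : ψ 0 = p)
    (h₁ : ∀ q ∈ Metric.ball (0 : ℝ × ℝ) 1, ψ q ∈ A₁ ↔ q.2 = 0)
    (h₂ : ∀ q ∈ Metric.ball (0 : ℝ × ℝ) 1, ψ q ∈ A₂ ↔ q.1 = 0) : ProperCross A₁ A₂ p := by
  let B := Metric.ball (0 : ℝ × ℝ) 1
  let φ : (ψ '' B) ≃ₜ (ℝ × ℝ) := (ψ.image B).symm.trans Homeomorph.unitBall.symm
  have hφ : ∀ q : ℝ × ℝ, ((φ.symm q : ψ '' B) : ℝ × ℝ) =
      ψ (Homeomorph.unitBall q : ℝ × ℝ) := fun q => rfl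
  have key : ∀ (A : Set (ℝ × ℝ)) (S : Set (ℝ × ℝ)),
      (∀ q, ψ (Homeomorph.unitBall q : ℝ × ℝ) ∈ A ↔ q ∈ S) →
      (fun x => φ x) '' {x : (ψ '' B) | (x : ℝ × ℝ) ∈ A} = S := by
    intro A S h
    ext q
    constructor
    · rintro ⟨x, hx, rfl⟩
      rw [← h, ← hφ]
      simpa using hx
    · intro hq
      exact ⟨φ.symm q, by rw [mem_ofPred_eq, hφ, h]; exact hq, by simp⟩
  have scal : ∀ q : ℝ × ℝ, (√(1 + ‖q‖ ^ 2))⁻¹ ≠ 0 := fun q =>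
    inv_ne_zero (Real.sqrt_ne_zero'.mpr (by positivity))
  have hp : p ∈ ψ '' B := ⟨0, by simp [B], h0⟩
  refine ⟨ψ '' B, ψ.isOpenMap _ Metric.isOpen_ball, hp, φ, ?_, key _ _ ?_, key _ _ ?_⟩
  · rw [← φ.eq_symm_apply]
    ext1
    rw [hφ]
    change p = ψ (Homeomorph.unitBall (0 : ℝ × ℝ) : ℝ × ℝ)
    rw [Homeomorph.coe_unitBall_apply_zero, h0]
  · intro q
    rw [h₁ _ (Homeomorph.unitBall q).2, Homeomorph.unitBall_apply_coe,
      OpenPartialHomeomorph.univUnitBall_apply, Prod.smul_snd, smul_eq_mul, mul_eq_zero]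
    exact or_iff_right (scal q)
  · intro q
    rw [h₂ _ (Homeomorph.unitBall q).2, Homeomorph.unitBall_apply_coe,
      OpenPartialHomeomorph.univUnitBall_apply, Prod.smul_fst, smul_eq_mul, mul_eq_zero]
    exact or_iff_right (scal q)

/-- The affine parametrization of the plane with origin `p` and independent axes `u` and `v`. -/
noncomputable def affineFrame (p u v : ℝ × ℝ) (h : u.1 * v.2 - u.2 * v.1 ≠ 0) :
    (ℝ × ℝ) ≃ₜ (ℝ × ℝ) where
  toFun q := (p.1 + q.1 * u.1 + q.2 * v.1, p.2 + q.1 * u.2 + q.2 * v.2)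
  invFun x := (((x.1 - p.1) * v.2 - (x.2 - p.2) * v.1) / (u.1 * v.2 - u.2 * v.1),
    (u.1 * (x.2 - p.2) - u.2 * (x.1 - p.1)) / (u.1 * v.2 - u.2 * v.1))
  left_inv q := by
    ext
    · simp only; rw [div_eq_iff h]; ring
    · simp only; rw [div_eq_iff h]; ring
  right_inv x := by
    ext
    · simp only; rw [div_mul_eq_mul_div, div_mul_eq_mul_div, add_assoc, ← add_div,
        ← eq_sub_iff_add_eq', div_eq_iff h]; ring
    · simp only; rw [div_mul_eq_mul_div, div_mul_eq_mul_div, add_assoc, ← add_div,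
        ← eq_sub_iff_add_eq', div_eq_iff h]; ring
  continuous_toFun := by fun_prop
  continuous_invFun := by fun_prop

/-- Twice the signed area of the triangle `p q r`. -/
def orient {R : Type*} [CommRing R] (p q r : R × R) : R :=
  (q.1 - p.1) * (r.2 - p.2) - (q.2 - p.2) * (r.1 - p.1)

lemma mem_segment_iff_coord {p q x : ℝ × ℝ} : x ∈ segment ℝ p q ↔
    ∃ t ∈ Icc (0 : ℝ) 1, x.1 = p.1 + t * (q.1 - p.1) ∧ x.2 = p.2 + t * (q.2 - p.2) := by
  rw [segment_eq_image']
  constructor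
  · rintro ⟨t, ht, rfl⟩
    exact ⟨t, ht, by simp, by simp⟩
  · rintro ⟨t, ht, h1, h2⟩
    exact ⟨t, ht, by ext <;> simp [h1, h2]⟩

lemma orient_eq_zero_of_mem_segment {p q x : ℝ × ℝ} (hx : x ∈ segment ℝ p q) :
    orient p q x = 0 := by
  obtain ⟨t, -, h1, h2⟩ := mem_segment_iff_coord.mp hx
  rw [orient, h1, h2]; ring

lemma orient_affine {p q r s x : ℝ × ℝ} {t : ℝ}
    (h1 : x.1 = r.1 + t * (s.1 - r.1)) (h2 : x.2 = r.2 + t * (s.2 - r.2)) :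
    orient p q x = (1 - t) * orient p q r + t * orient p q s := by
  simp only [orient, h1, h2]; ring

lemma orient_mul_nonpos {p q r s x : ℝ × ℝ} (hx : x ∈ segment ℝ p q) (hx' : x ∈ segment ℝ r s) :
    orient p q r * orient p q s ≤ 0 := by
  obtain ⟨t, ⟨ht0, ht1⟩, h1, h2⟩ := mem_segment_iff_coord.mp hx'
  have := orient_affine (p := p) (q := q) h1 h2
  rw [orient_eq_zero_of_mem_segment hx] at this
  by_contra! h
  rcases mul_pos_iff.mp h with ⟨h3, h4⟩ | ⟨h3, h4⟩ <;>
    rcases ht0.eq_or_lt with rfl | ht0 <;> nlinarith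

lemma eq_of_mem_segment_of_mem_segment {p q r x : ℝ × ℝ} (h : orient p q r ≠ 0)
    (hx : x ∈ segment ℝ p q) (hx' : x ∈ segment ℝ p r) : x = p := by
  obtain ⟨t, -, h1, h2⟩ := mem_segment_iff_coord.mp hx'
  have := orient_affine (p := p) (q := q) h1 h2
  rw [orient_eq_zero_of_mem_segment hx] at this
  have h0 : orient p q p = 0 := by simp [orient]
  have ht : t = 0 := by simpa [h0, h] using this
  ext <;> simp [h1, h2, ht]

lemma segment_inter_subsingleton {p q r s x y : ℝ × ℝ} (h : orient p q r ≠ 0)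
    (hx : x ∈ segment ℝ p q) (hx' : x ∈ segment ℝ r s)
    (hy : y ∈ segment ℝ p q) (hy' : y ∈ segment ℝ r s) : x = y := by
  obtain ⟨t, -, h1, h2⟩ := mem_segment_iff_coord.mp hx'
  obtain ⟨u, -, h3, h4⟩ := mem_segment_iff_coord.mp hy'
  have e1 := orient_affine (p := p) (q := q) h1 h2
  have e2 := orient_affine (p := p) (q := q) h3 h4
  rw [orient_eq_zero_of_mem_segment hx] at e1
  rw [orient_eq_zero_of_mem_segment hy] at e2
  have htu : t = u := by
    by_contra htu
    have h5 : (t - u) * (orient p q s - orient p q r) = 0 := by linear_combination e2 - e1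
    have h6 := (mul_eq_zero.mp h5).resolve_left (sub_ne_zero.mpr htu)
    apply h
    linear_combination -e1 - t * h6
  ext <;> simp [h1, h2, h3, h4, htu]

lemma affineFrame_mem_segment_iff {p q x v : ℝ × ℝ} {t ε : ℝ} (hε : 0 < ε)
    (ht : ε ≤ t) (ht' : ε ≤ 1 - t)
    (h1 : x.1 = p.1 + t * (q.1 - p.1)) (h2 : x.2 = p.2 + t * (q.2 - p.2))
    (hv : (q.1 - p.1) * v.2 - (q.2 - p.2) * v.1 ≠ 0) {a b : ℝ} (ha : |a| < 1) :
    (x.1 + a * (ε * (q.1 - p.1)) + b * v.1, x.2 + a * (ε * (q.2 - p.2)) + b * v.2)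
      ∈ segment ℝ p q ↔ b = 0 := by
  constructor
  · intro h
    have := orient_eq_zero_of_mem_segment h
    have h3 : b * ((q.1 - p.1) * v.2 - (q.2 - p.2) * v.1) = 0 := by
      rw [← this, orient, h1, h2]; ring
    exact (mul_eq_zero.mp h3).resolve_right hv
  · rintro rfl
    obtain ⟨ha1, ha2⟩ := abs_lt.mp ha
    refine mem_segment_iff_coord.mpr ⟨t + a * ε, ⟨by nlinarith, by nlinarith⟩, ?_, ?_⟩
    · simp only [h1]; ring
    · simp only [h2]; ring

/-- Two segments without collinear triples among their end points properly cross wherever they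
meet. -/
lemma properCross_segment {p q r s x : ℝ × ℝ} (hr : orient p q r ≠ 0) (hs : orient p q s ≠ 0)
    (hp : orient r s p ≠ 0) (hq : orient r s q ≠ 0)
    (hx : x ∈ segment ℝ p q) (hx' : x ∈ segment ℝ r s) :
    ProperCross (segment ℝ p q) (segment ℝ r s) x := by
  have o1 := orient_eq_zero_of_mem_segment hx
  have o2 := orient_eq_zero_of_mem_segment hx'
  obtain ⟨t, ⟨t0, t1⟩, h1, h2⟩ := mem_segment_iff_coord.mp hx
  obtain ⟨u, ⟨u0, u1⟩, h3, h4⟩ := mem_segment_iff_coord.mp hx'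
  have e1 := orient_affine (p := r) (q := s) h1 h2
  have e2 := orient_affine (p := p) (q := q) h3 h4
  rw [o2] at e1
  rw [o1] at e2
  have t0' : 0 < t := t0.lt_of_ne (by rintro rfl; apply hp; linarith)
  have t1' : t < 1 := t1.lt_of_ne (by rintro rfl; apply hq; linarith)
  have u0' : 0 < u := u0.lt_of_ne (by rintro rfl; apply hr; linarith)
  have u1' : u < 1 := u1.lt_of_ne (by rintro rfl; apply hs; linarith)
  obtain ⟨ε, hε, k1, k2, k3, k4⟩ : ∃ ε : ℝ, 0 < ε ∧ ε ≤ t ∧ ε ≤ 1 - t ∧ ε ≤ u ∧ ε ≤ 1 - u :=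
    ⟨min (min t (1 - t)) (min u (1 - u)), by simp; grind, by simp, by simp, by simp, by simp⟩
  have hD : (q.1 - p.1) * (s.2 - r.2) - (q.2 - p.2) * (s.1 - r.1) ≠ 0 := by
    intro h
    have h5 : orient p q s - orient p q r = 0 := by rw [← h]; simp only [orient]; ring
    apply hr
    linear_combination -e2 - u * h5
  have hD' : (ε * (q.1 - p.1)) * (ε * (s.2 - r.2)) - (ε * (q.2 - p.2)) * (ε * (s.1 - r.1)) ≠ 0 := by
    intro h
    have : ε * ε * ((q.1 - p.1) * (s.2 - r.2) - (q.2 - p.2) * (s.1 - r.1)) = 0 := by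
      rw [← h]; ring
    simp [hε.ne', hD] at this
  refine properCross_of_homeomorph (affineFrame x (ε * (q.1 - p.1), ε * (q.2 - p.2))
    (ε * (s.1 - r.1), ε * (s.2 - r.2)) hD') ?_ ?_ ?_
  · simp [affineFrame]
  · rintro ⟨a, b⟩ hab
    rw [mem_ball_zero_iff, Prod.norm_def, max_lt_iff] at hab
    refine affineFrame_mem_segment_iff hε k1 k2 h1 h2 (fun h => hD' ?_) hab.1
    linear_combination ε * h
  · rintro ⟨a, b⟩ hab
    rw [mem_ball_zero_iff, Prod.norm_def, max_lt_iff] at hab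
    have := affineFrame_mem_segment_iff (b := a) (v := (ε * (q.1 - p.1), ε * (q.2 - p.2)))
      hε k3 k4 h3 h4 (fun h => hD' ?_) hab.2
    · rw [← this]
      simp only [affineFrame, Homeomorph.homeomorph_mk_coe, Equiv.coe_fn_mk, add_right_comm]
    · linear_combination -ε * h


open Complex in
/-- Two continuous functions on the line whose exponentials are proportional have the same
increment on `[0, 1]`. -/
lemma log_increment_unique {L L' : ℝ → ℂ} (hL : Continuous L) (hL' : Continuous L') (c : ℂ)
    (h : ∀ t, exp (L t) = c * exp (L' t)) : L 1 - L 0 = L' 1 - L' 0 := by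
  have key := isCoveringMap_exp.eq_of_comp_eq (A := ℝ) (g₁ := fun t => L t)
    (g₂ := fun t => L' t + (L 0 - L' 0)) (by fun_prop) (by fun_prop)
    (by
      funext t
      simp only [Function.comp, Subtype.mk.injEq]
      rw [exp_add, exp_sub, h, h]
      field_simp [exp_ne_zero]) 0 (by ring)
  have := congrFun key 1
  rw [this]; ring

open Complex in
/-- A nowhere vanishing continuous complex function on the plane has a continuous logarithm. -/
lemma exists_continuous_log {F : ℝ × ℝ → ℂ} (hF : Continuous F) (h0 : ∀ x, F x ≠ 0) :
    ∃ L : ℝ × ℝ → ℂ, Continuous L ∧ ∀ x, exp (L x) = F x := by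
  obtain ⟨f, ⟨-, hf⟩, -⟩ := isCoveringMapOn_exp.existsUnique_continuousMap_lifts
    ⟨F, hF⟩ (exp_log (h0 0)) h0
  exact ⟨f, f.continuous, congrFun hf⟩

open Complex in
lemma exists_continuous_log_path {F : ℝ → ℂ} (hF : Continuous F) (h0 : ∀ x, F x ≠ 0) :
    ∃ L : ℝ → ℂ, Continuous L ∧ ∀ x, exp (L x) = F x := by
  obtain ⟨L, hL, h⟩ := exists_continuous_log (F := fun x => F x.1) (by fun_prop) (fun x => h0 _)
  exact ⟨fun t => L (t, 0), by fun_prop, fun t => h _⟩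

open Complex in
/-- The total angular increments along the boundary of the square, for the difference of two
disjoint paths, add up to zero. -/
lemma log_increment_square {f g : ℝ → ℂ} (hf : Continuous f) (hg : Continuous g)
    (hfg : ∀ s t, f s ≠ g t) {A B C D : ℝ → ℂ}
    (hA : Continuous A) (hB : Continuous B) (hC : Continuous C) (hD : Continuous D)
    (eA : ∀ s, exp (A s) = f s - g 0) (eB : ∀ t, exp (B t) = g t - f 1)
    (eC : ∀ t, exp (C t) = g t - f 0) (eD : ∀ s, exp (D s) = f s - g 1) :
    (A 1 - A 0) + (B 1 - B 0) = (C 1 - C 0) + (D 1 - D 0) := by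
  obtain ⟨L, hL, h⟩ := exists_continuous_log (F := fun x => f x.1 - g x.2) (by fun_prop)
    (fun x => sub_ne_zero.mpr (hfg _ _))
  have h1 := log_increment_unique hA (L' := fun s => L (s, 0)) (by fun_prop) 1
    (fun t => by simp [h, eA])
  have h2 := log_increment_unique hB (L' := fun s => L (1, s)) (by fun_prop) (-1)
    (fun t => by simp [h, eB])
  have h3 := log_increment_unique hC (L' := fun s => L (0, s)) (by fun_prop) (-1)
    (fun t => by simp [h, eC])
  have h4 := log_increment_unique hD (L' := fun s => L (s, 1)) (by fun_prop) 1
    (fun t => by simp [h, eD])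
  rw [h1, h2, h3, h4]; ring

open Complex in
/-- A choice of logarithms for the differences of distinct points, such that exchanging the points
changes the logarithm by `π i`. -/
lemma exists_log_differences (a : Fin 3 → ℂ) (ha : Function.Injective a) :
    ∃ Q : Fin 3 → Fin 3 → ℂ, (∀ i k, i ≠ k → exp (Q i k) = a i - a k) ∧
      ∀ i k, i < k → Q k i = Q i k + Real.pi * I := by
  refine ⟨fun i k => if i < k then log (a i - a k) else log (a k - a i) + Real.pi * I, ?_, ?_⟩
  · intro i k hik
    have h1 : a i - a k ≠ 0 := sub_ne_zero.mpr fun h => hik (ha h)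
    have h2 : a k - a i ≠ 0 := sub_ne_zero.mpr fun h => hik (ha h.symm)
    simp only
    split_ifs
    · exact exp_log h1
    · rw [exp_add, exp_log h2, exp_pi_mul_I]; ring
  · intro i k hik
    simp [hik, hik.le.not_gt]

open Complex in
/-- There is no family of nine paths joining three points to three points such that
paths without common index are disjoint. -/
theorem no_disjoint_paths_K33 (a b : Fin 3 → ℂ) (γ : Fin 3 → Fin 3 → ℝ → ℂ)
    (hc : ∀ i j, Continuous (γ i j)) (h0 : ∀ i j, γ i j 0 = a i) (h1 : ∀ i j, γ i j 1 = b j)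
    (hd : ∀ i j k l, i ≠ k → j ≠ l → ∀ s t, γ i j s ≠ γ k l t) : False := by
  have other : ∀ i : Fin 3, ∃ k, i ≠ k := by decide
  have ha : Function.Injective a := by
    intro i k h
    by_contra hik
    exact hd i 0 k 1 hik (by decide) 0 0 (by rw [h0, h0, h])
  have hb : Function.Injective b := by
    intro i k h
    by_contra hik
    exact hd 0 i 1 k (by decide) hik 1 1 (by rw [h1, h1, h])
  have hab : ∀ i j, a i - b j ≠ 0 := by
    intro i j
    obtain ⟨k, hk⟩ := other i
    obtain ⟨l, hl⟩ := other j
    have := hd i l k j hk hl.symm 0 1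
    rw [h0, h1] at this
    exact sub_ne_zero.mpr this
  obtain ⟨Q, hQ, hQ'⟩ := exists_log_differences a ha
  obtain ⟨R, hR, hR'⟩ := exists_log_differences b hb
  obtain ⟨A, hA⟩ : ∃ A : Fin 3 → Fin 3 → Fin 3 → ℝ → ℂ, ∀ i j k, i ≠ k →
      Continuous (A i j k) ∧ ∀ t, exp (A i j k t) = γ i j t - a k := by
    have : ∀ i j k, ∃ A : ℝ → ℂ, i ≠ k → Continuous A ∧ ∀ t, exp (A t) = γ i j t - a k := by
      intro i j k
      by_cases hik : i = k
      · exact ⟨0, fun h => absurd hik h⟩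
      obtain ⟨l, hl⟩ := other j
      obtain ⟨L, hL, hL'⟩ := exists_continuous_log_path (F := fun t => γ i j t - a k)
        ((hc i j).sub continuous_const)
        (fun t => sub_ne_zero.mpr (by rw [← h0 k l]; exact hd i j k l hik hl t 0))
      exact ⟨L, fun _ => ⟨hL, hL'⟩⟩
    choose A hA using this
    exact ⟨A, hA⟩
  obtain ⟨B, hB⟩ : ∃ B : Fin 3 → Fin 3 → Fin 3 → ℝ → ℂ, ∀ i j l, j ≠ l →
      Continuous (B i j l) ∧ ∀ t, exp (B i j l t) = γ i j t - b l := by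
    have : ∀ i j l, ∃ B : ℝ → ℂ, j ≠ l → Continuous B ∧ ∀ t, exp (B t) = γ i j t - b l := by
      intro i j l
      by_cases hjl : j = l
      · exact ⟨0, fun h => absurd hjl h⟩
      obtain ⟨k, hk⟩ := other i
      obtain ⟨L, hL, hL'⟩ := exists_continuous_log_path (F := fun t => γ i j t - b l)
        ((hc i j).sub continuous_const)
        (fun t => sub_ne_zero.mpr (by rw [← h1 k l]; exact hd i j k l hk hjl t 1))
      exact ⟨L, fun _ => ⟨hL, hL'⟩⟩
    choose B hB using this
    exact ⟨B, hB⟩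
  have hn : ∀ i j k, ∃ n : ℤ, i ≠ k →
      A i j k 1 - A i j k 0 = log (a k - b j) + Real.pi * I - Q i k + n * (2 * Real.pi * I) := by
    intro i j k
    by_cases hik : i = k
    · exact ⟨0, fun h => absurd hik h⟩
    have : exp (A i j k 1 - A i j k 0) = exp (log (a k - b j) + Real.pi * I - Q i k) := by
      rw [exp_sub, exp_sub, exp_add, (hA i j k hik).2, (hA i j k hik).2, exp_log (hab _ _),
        hQ i k hik, exp_pi_mul_I, h0, h1]
      ring
    obtain ⟨n, hn⟩ := exp_eq_exp_iff_exists_int.mp this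
    exact ⟨n, fun _ => hn⟩
  have hm : ∀ i j l, ∃ m : ℤ, j ≠ l →
      B i j l 1 - B i j l 0 = R j l - log (a i - b l) + m * (2 * Real.pi * I) := by
    intro i j l
    by_cases hjl : j = l
    · exact ⟨0, fun h => absurd hjl h⟩
    have : exp (B i j l 1 - B i j l 0) = exp (R j l - log (a i - b l)) := by
      rw [exp_sub, exp_sub, (hB i j l hjl).2, (hB i j l hjl).2, exp_log (hab _ _),
        hR j l hjl, h0, h1]
    obtain ⟨n, hn⟩ := exp_eq_exp_iff_exists_int.mp this
    exact ⟨n, fun _ => hn⟩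
  choose n hn using hn
  choose m hm using hm
  have hπ : (2 * Real.pi * I : ℂ) ≠ 0 := two_pi_I_ne_zero
  have sq : ∀ i j k l, i ≠ k → j ≠ l →
      (Q k i - Q i k) + (R l j - R j l) +
        (n i j k + m k l j - n k l i - m i j l) * (2 * Real.pi * I) = 0 := by
    intro i j k l hik hjl
    have := log_increment_square (hc i j) (hc k l) (hd i j k l hik hjl)
      (hA i j k hik).1 (hB k l j hjl.symm).1 (hA k l i hik.symm).1 (hB i j l hjl).1
      (fun s => by rw [(hA i j k hik).2, h0]) (fun s => by rw [(hB k l j hjl.symm).2, h1])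
      (fun s => by rw [(hA k l i hik.symm).2, h0]) (fun s => by rw [(hB i j l hjl).2, h1])
    rw [hn i j k hik, hm k l j hjl.symm, hn k l i hik.symm, hm i j l hjl] at this
    linear_combination this
  have odd : ∀ i j k l, i < k → j < l → n i j k + m k l j - n k l i - m i j l = -1 := by
    intro i j k l hik hjl
    have := sq i j k l hik.ne hjl.ne
    rw [hQ' i k hik, hR' j l hjl] at this
    have h2 : ((n i j k + m k l j - n k l i - m i j l + 1 : ℤ) : ℂ) * (2 * Real.pi * I) = 0 := by
      push_cast; linear_combination this
    have h3 := (mul_eq_zero.mp h2).resolve_right hπ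
    have h4 : n i j k + m k l j - n k l i - m i j l + 1 = 0 := by exact_mod_cast h3
    linarith
  have even : ∀ i j k l, i < k → l < j → n i j k + m k l j - n k l i - m i j l = 0 := by
    intro i j k l hik hjl
    have := sq i j k l hik.ne hjl.ne'
    rw [hQ' i k hik, hR' l j hjl] at this
    have h2 : ((n i j k + m k l j - n k l i - m i j l : ℤ) : ℂ) * (2 * Real.pi * I) = 0 := by
      push_cast; linear_combination this
    have h3 := (mul_eq_zero.mp h2).resolve_right hπ
    exact_mod_cast h3
  have sum : ∀ i k, i < k → ∃ N : ℤ,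
      m i 0 1 + m i 0 2 + m i 1 0 + m i 1 2 + m i 2 0 + m i 2 1 +
      m k 0 1 + m k 0 2 + m k 1 0 + m k 1 2 + m k 2 0 + m k 2 1 = 2 * N + 1 := by
    intro i k hik
    have e1 := odd i 0 k 1 hik (by decide)
    have e2 := odd i 0 k 2 hik (by decide)
    have e3 := odd i 1 k 2 hik (by decide)
    have e4 := even i 1 k 0 hik (by decide)
    have e5 := even i 2 k 0 hik (by decide)
    have e6 := even i 2 k 1 hik (by decide)
    exact ⟨m i 0 1 + m i 0 2 + m i 1 0 + m i 1 2 + m i 2 0 + m i 2 1 - 2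
      - (n i 0 k + n i 1 k + n i 2 k) + (n k 0 i + n k 1 i + n k 2 i), by linarith⟩
  obtain ⟨N1, e1⟩ := sum 0 1 (by decide)
  obtain ⟨N2, e2⟩ := sum 0 2 (by decide)
  obtain ⟨N3, e3⟩ := sum 1 2 (by decide)
  omega

namespace Drawing

lemma mem_of_pos_mem_arcIm {V : Type*} {G : SimpleGraph V} (D : Drawing G) {e : G.edgeSet} {v : V}
    (h : D.pos v ∈ D.arcIm e) : v ∈ (e : Sym2 V) := by
  by_contra hv
  exact D.no_vertex_interior e v hv h

/-- The drawing of a subgraph obtained by restricting a drawing. -/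
def comap {V W : Type*} {G : SimpleGraph V} {H : SimpleGraph W} (D : Drawing H) (f : G →g H)
    (hf : Function.Injective f) : Drawing G where
  pos v := D.pos (f v)
  pos_inj := D.pos_inj.comp hf
  arc e := D.arc (f.mapEdgeSet e)
  arc_cont _ := D.arc_cont _
  arc_inj _ := D.arc_inj _
  arc_ends e := by
    obtain ⟨x, y, hxy, h0, h1⟩ := D.arc_ends (f.mapEdgeSet e)
    obtain ⟨e, he⟩ := e
    induction e with | _ u v =>
    have : s(f u, f v) = s(x, y) := hxy
    rcases Sym2.eq_iff.mp this with ⟨rfl, rfl⟩ | ⟨rfl, rfl⟩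
    · exact ⟨u, v, rfl, h0, h1⟩
    · exact ⟨v, u, Sym2.eq_swap, h0, h1⟩
  no_vertex_interior e v hv := D.no_vertex_interior _ _ fun h => hv <| by
    obtain ⟨w, hw, hwv⟩ := Sym2.mem_map.mp h
    exact hf hwv ▸ hw
  shared_endpoint e₁ e₂ h v h₁ h₂ := D.shared_endpoint _ _
    (fun h' => h (SimpleGraph.Hom.mapEdgeSet.injective f hf h')) (f v)
    (Sym2.mem_map.mpr ⟨v, h₁, rfl⟩) (Sym2.mem_map.mpr ⟨v, h₂, rfl⟩)
  finite_meet e₁ e₂ h := D.finite_meet _ _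
    (fun h' => h (SimpleGraph.Hom.mapEdgeSet.injective f hf h'))
  proper e₁ e₂ h p hp hpos := D.proper _ _
    (fun h' => h (SimpleGraph.Hom.mapEdgeSet.injective f hf h')) p hp <| by
      rintro ⟨w, rfl⟩
      obtain ⟨v, -, rfl⟩ := Sym2.mem_map.mp (D.mem_of_pos_mem_arcIm hp.1)
      exact hpos ⟨v, rfl⟩
  at_most_two p hpos e₁ e₂ e₃ h₁ h₂ h₃ := by
    have inj := SimpleGraph.Hom.mapEdgeSet.injective f hf
    have := D.at_most_two p (by
      rintro ⟨w, rfl⟩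
      obtain ⟨v, -, rfl⟩ := Sym2.mem_map.mp (D.mem_of_pos_mem_arcIm h₁)
      exact hpos ⟨v, rfl⟩) _ _ _ h₁ h₂ h₃
    simpa only [inj.eq_iff] using this

section comap

variable {V W : Type*} {G : SimpleGraph V} {H : SimpleGraph W} (D : Drawing H) (f : G →g H)
  (hf : Function.Injective f)

lemma crossings_comap_subset : (D.comap f hf).crossings ⊆ D.crossings := by
  rintro p ⟨hpos, e₁, e₂, hne, h₁, h₂⟩
  refine ⟨?_, f.mapEdgeSet e₁, f.mapEdgeSet e₂,
    fun h' => hne (SimpleGraph.Hom.mapEdgeSet.injective f hf h'), h₁, h₂⟩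
  rintro ⟨w, rfl⟩
  obtain ⟨v, -, rfl⟩ := Sym2.mem_map.mp (D.mem_of_pos_mem_arcIm (e := f.mapEdgeSet e₁) h₁)
  exact hpos ⟨v, rfl⟩

lemma image_cluster_comap_subset (c : ℝ × ℝ) : f '' (D.comap f hf).cluster c ⊆ D.cluster c := by
  rintro _ ⟨v, ⟨e, hc, hv⟩, rfl⟩
  exact ⟨f.mapEdgeSet e, hc, Sym2.mem_map.mpr ⟨v, hv, rfl⟩⟩

lemma IsNICPlanar.comap [Finite W] {D : Drawing H} (hD : D.IsNICPlanar) :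
    (D.comap f hf).IsNICPlanar := by
  refine ⟨fun e p hp q hq => hD.1 (f.mapEdgeSet e) ⟨D.crossings_comap_subset f hf hp.1, hp.2⟩
    ⟨D.crossings_comap_subset f hf hq.1, hq.2⟩, fun c hc c' hc' hne => ?_⟩
  refine le_trans ?_ (hD.2 c (D.crossings_comap_subset f hf hc) c'
    (D.crossings_comap_subset f hf hc') hne)
  rw [← ncard_image_of_injective _ hf, image_inter hf]
  exact ncard_le_ncard (inter_subset_inter (D.image_cluster_comap_subset f hf c)
    (D.image_cluster_comap_subset f hf c')) (toFinite _)

end comap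

end Drawing

lemma SimpleGraph.NICPlanar.of_hom {V W : Type*} [Finite W] {G : SimpleGraph V}
    {H : SimpleGraph W} (hH : H.NICPlanar) (f : G →g H) (hf : Function.Injective f) :
    G.NICPlanar :=
  let ⟨D, hD⟩ := hH
  ⟨D.comap f hf, hD.comap f hf⟩

lemma nicPlanar_completeBipartiteGraph_mono {m n m' n' : ℕ} (hm : m ≤ m') (hn : n ≤ n')
    (h : (completeBipartiteGraph (Fin m') (Fin n')).NICPlanar) :
    (completeBipartiteGraph (Fin m) (Fin n)).NICPlanar := by
  refine h.of_hom ⟨Sum.map (Fin.castLE hm) (Fin.castLE hn), ?_⟩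
    ((Fin.castLE_injective hm).sumMap (Fin.castLE_injective hn))
  rintro (i | i) (j | j) <;> simp [completeBipartiteGraph]

/-- The edge of a complete bipartite graph with given ends. -/
def bipartiteEdge {α β : Type*} (i : α) (j : β) : (completeBipartiteGraph α β).edgeSet :=
  ⟨s(Sum.inl i, Sum.inr j), by simp [completeBipartiteGraph]⟩

section bipartiteEdge

variable {α β : Type*}

@[simp] lemma coe_bipartiteEdge (i : α) (j : β) :
    (bipartiteEdge i j : Sym2 (α ⊕ β)) = s(Sum.inl i, Sum.inr j) := rfl

lemma bipartiteEdge_inj {i k : α} {j l : β} :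
    bipartiteEdge i j = bipartiteEdge k l ↔ i = k ∧ j = l := by
  simp [Subtype.ext_iff]

lemma exists_eq_bipartiteEdge (e : (completeBipartiteGraph α β).edgeSet) :
    ∃ i j, e = bipartiteEdge i j := by
  obtain ⟨e, he⟩ := e
  induction e with | _ u v =>
  rcases u with i | i <;> rcases v with j | j
  · simp [completeBipartiteGraph] at he
  · exact ⟨i, j, rfl⟩
  · exact ⟨j, i, Subtype.ext Sym2.eq_swap⟩
  · simp [completeBipartiteGraph] at he

/-- The end of an edge in the first part. -/
noncomputable def leftEnd (e : (completeBipartiteGraph α β).edgeSet) : α :=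
  (exists_eq_bipartiteEdge e).choose

/-- The end of an edge in the second part. -/
noncomputable def rightEnd (e : (completeBipartiteGraph α β).edgeSet) : β :=
  (exists_eq_bipartiteEdge e).choose_spec.choose

lemma eq_bipartiteEdge (e : (completeBipartiteGraph α β).edgeSet) :
    e = bipartiteEdge (leftEnd e) (rightEnd e) :=
  (exists_eq_bipartiteEdge e).choose_spec.choose_spec

@[simp] lemma leftEnd_bipartiteEdge (i : α) (j : β) : leftEnd (bipartiteEdge i j) = i :=
  (bipartiteEdge_inj.mp (eq_bipartiteEdge (bipartiteEdge i j))).1.symm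

@[simp] lemma rightEnd_bipartiteEdge (i : α) (j : β) : rightEnd (bipartiteEdge i j) = j :=
  (bipartiteEdge_inj.mp (eq_bipartiteEdge (bipartiteEdge i j))).2.symm

end bipartiteEdge

namespace Drawing

section bipartite

variable {α β : Type*} (D : Drawing (completeBipartiteGraph α β))

lemma exists_path (i : α) (j : β) : ∃ γ : ℝ → ℝ × ℝ, Continuous γ ∧ γ 0 = D.pos (Sum.inl i) ∧
    γ 1 = D.pos (Sum.inr j) ∧ ∀ t, γ t ∈ D.arcIm (bipartiteEdge i j) := by
  obtain ⟨u, v, huv, h0, h1⟩ := D.arc_ends (bipartiteEdge i j)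
  have hI : ∀ t, (projIcc (0 : ℝ) 1 zero_le_one t : ℝ) ∈ Icc (0 : ℝ) 1 := fun t => Subtype.prop _
  have hc : Continuous fun t => D.arc (bipartiteEdge i j) (projIcc (0 : ℝ) 1 zero_le_one t) :=
    (D.arc_cont _).comp_continuous (continuous_subtype_val.comp continuous_projIcc) hI
  rcases Sym2.eq_iff.mp huv with ⟨rfl, rfl⟩ | ⟨rfl, rfl⟩
  · exact ⟨_, hc, by simpa using h0, by simpa using h1, fun t => ⟨_, hI t, rfl⟩⟩
  · exact ⟨_, hc.comp (continuous_const.sub continuous_id : Continuous fun t : ℝ => 1 - t),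
      by simpa using h1, by simpa using h0, fun t => ⟨_, hI _, rfl⟩⟩

/-- The pairs of vertex sets of independent edges whose arcs meet. -/
def crossingPairs [DecidableEq α] [DecidableEq β] : Set (Finset α × Finset β) :=
  {S | ∃ i j k l, i ≠ k ∧ j ≠ l ∧ S = ({i, k}, {j, l}) ∧
    (D.arcIm (bipartiteEdge i j) ∩ D.arcIm (bipartiteEdge k l)).Nonempty}

variable {D}

lemma mem_crossings_of_independent {i k : α} {j l : β} (hik : i ≠ k) (hjl : j ≠ l) {c : ℝ × ℝ}
    (h₁ : c ∈ D.arcIm (bipartiteEdge i j)) (h₂ : c ∈ D.arcIm (bipartiteEdge k l)) :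
    c ∈ D.crossings := by
  refine ⟨?_, _, _, fun h => hik (bipartiteEdge_inj.mp h).1, h₁, h₂⟩
  rintro ⟨v, rfl⟩
  have m₁ := D.mem_of_pos_mem_arcIm h₁
  have m₂ := D.mem_of_pos_mem_arcIm h₂
  simp only [coe_bipartiteEdge, Sym2.mem_iff] at m₁ m₂
  rcases m₁ with rfl | rfl <;> simp_all

lemma disjSum_subset_cluster [DecidableEq α] [DecidableEq β] {i k : α} {j l : β} {c : ℝ × ℝ}
    (h₁ : c ∈ D.arcIm (bipartiteEdge i j)) (h₂ : c ∈ D.arcIm (bipartiteEdge k l)) :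
    ((Finset.disjSum {i, k} {j, l} : Finset (α ⊕ β)) : Set (α ⊕ β)) ⊆ D.cluster c := by
  rintro (v | v) hv
  · have : v = i ∨ v = k := by simpa using hv
    rcases this with rfl | rfl
    · exact ⟨_, h₁, by simp⟩
    · exact ⟨_, h₂, by simp⟩
  · have : v = j ∨ v = l := by simpa using hv
    rcases this with rfl | rfl
    · exact ⟨_, h₁, by simp⟩
    · exact ⟨_, h₂, by simp⟩

lemma IsNICPlanar.card_inter_crossingPairs [Finite α] [Finite β] [DecidableEq α] [DecidableEq β]
    (hD : D.IsNICPlanar) {S T : Finset α × Finset β}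
    (hS : S ∈ D.crossingPairs) (hT : T ∈ D.crossingPairs) (hne : S ≠ T) :
    (S.1 ∩ T.1).card + (S.2 ∩ T.2).card ≤ 1 := by
  obtain ⟨i, j, k, l, hik, hjl, rfl, c, h₁, h₂⟩ := hS
  obtain ⟨i', j', k', l', hik', hjl', rfl, c', h₁', h₂'⟩ := hT
  have hc := mem_crossings_of_independent hik hjl h₁ h₂
  have hc' := mem_crossings_of_independent hik' hjl' h₁' h₂'
  by_cases hcc : c = c'
  · subst hcc
    exfalso
    have a₁ := D.at_most_two c hc.1 _ _ _ h₁ h₂ h₁'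
    have a₂ := D.at_most_two c hc.1 _ _ _ h₁ h₂ h₂'
    simp only [bipartiteEdge_inj] at a₁ a₂
    apply hne
    rcases a₁ with a₁ | ⟨rfl, rfl⟩ | ⟨rfl, rfl⟩
    · exact absurd a₁.1 hik
    · rcases a₂ with a₂ | a₂ | ⟨rfl, rfl⟩
      · exact absurd a₂.1 hik
      · exact absurd a₂.1 hik'
      · rfl
    · rcases a₂ with a₂ | ⟨rfl, rfl⟩ | a₂
      · exact absurd a₂.1 hik
      · rw [Finset.pair_comm i, Finset.pair_comm j]
      · exact absurd a₂.1 hik'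
  · rw [← Finset.card_disjSum, ← ncard_coe_finset]
    refine le_trans (ncard_le_ncard ?_ (toFinite _)) (hD.2 c hc c' hc' hcc)
    intro v hv
    refine ⟨disjSum_subset_cluster h₁ h₂ ?_, disjSum_subset_cluster h₁' h₂' ?_⟩ <;>
    · rcases v with v | v <;> simp at hv ⊢ <;> tauto

/-- In every drawing, each pair of triples contains a crossing pair of independent edges. -/
lemma exists_crossingPair [DecidableEq α] [DecidableEq β] (D : Drawing (completeBipartiteGraph α β))
    {A : Finset α} {B : Finset β} (hA : 3 ≤ A.card) (hB : 3 ≤ B.card) :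
    ∃ S ∈ D.crossingPairs, S.1 ⊆ A ∧ S.2 ⊆ B := by
  by_contra! hcon
  obtain ⟨f⟩ : Nonempty (Fin 3 ↪ A) := Function.Embedding.nonempty_of_card_le (by simpa using hA)
  obtain ⟨g⟩ : Nonempty (Fin 3 ↪ B) := Function.Embedding.nonempty_of_card_le (by simpa using hB)
  choose γ hc h0 h1 hmem using D.exists_path
  let ι := Complex.equivRealProdCLM.symm
  refine no_disjoint_paths_K33 (fun i => ι (D.pos (Sum.inl (f i : α))))
    (fun j => ι (D.pos (Sum.inr (g j : β)))) (fun i j t => ι (γ (f i) (g j) t))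
    (fun i j => ι.continuous.comp (hc _ _)) (fun i j => by rw [h0]) (fun i j => by rw [h1])
    fun i j k l hik hjl s t h => ?_
  have hst := ι.injective h
  refine hcon ({(f i : α), (f k : α)}, {(g j : β), (g l : β)}) ⟨f i, g j, f k, g l,
    fun h => hik (f.injective (Subtype.ext h)), fun h => hjl (g.injective (Subtype.ext h)), rfl,
    _, hmem _ _ s, hst ▸ hmem _ _ t⟩ ?_ ?_ <;>
  · intro v hv
    rcases Finset.mem_insert.mp hv with rfl | hv
    · exact Subtype.prop _
    · exact Finset.mem_singleton.mp hv ▸ Subtype.prop _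

lemma card_of_mem_crossingPairs [DecidableEq α] [DecidableEq β] {S : Finset α × Finset β}
    (hS : S ∈ D.crossingPairs) : S.1.card = 2 ∧ S.2.card = 2 := by
  obtain ⟨i, j, k, l, hik, hjl, rfl, -⟩ := hS
  exact ⟨Finset.card_pair hik, Finset.card_pair hjl⟩

end bipartite

end Drawing

lemma exists_subset_pair_of_no_three {γ : Type*} [Nonempty γ] {T : Set γ}
    (h : ∀ x ∈ T, ∀ y ∈ T, ∀ z ∈ T, x = y ∨ x = z ∨ y = z) : ∃ x y, T ⊆ {x, y} := by
  by_cases hT : T.Subsingleton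
  · rcases hT.eq_empty_or_singleton with rfl | ⟨x, rfl⟩
    · exact ⟨Classical.arbitrary γ, Classical.arbitrary γ, empty_subset _⟩
    · exact ⟨x, x, by simp⟩
  · obtain ⟨x, hx, y, hy, hxy⟩ := not_subsingleton_iff.mp hT
    refine ⟨x, y, fun z hz => ?_⟩
    have := h x hx y hy z hz
    grind

lemma Finset.not_subset_of_mem_notMem {α : Type*} {s t : Finset α} {a : α} (hs : a ∈ s)
    (ht : a ∉ t) : ¬ s ⊆ t := fun h => ht (h hs)

theorem not_nicPlanar_five_three : ¬ (completeBipartiteGraph (Fin 5) (Fin 3)).NICPlanar := by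
  rintro ⟨D, hD⟩
  have disj : ∀ S ∈ D.crossingPairs, ∀ T ∈ D.crossingPairs, S ≠ T → Disjoint S.1 T.1 := by
    intro S hS T hT hne
    have h1 := hD.card_inter_crossingPairs hS hT hne
    have h2 := Finset.card_union_add_card_inter S.2 T.2
    have h3 := Finset.card_le_univ (S.2 ∪ T.2)
    rw [(Drawing.card_of_mem_crossingPairs hS).2, (Drawing.card_of_mem_crossingPairs hT).2] at h2
    rw [Fintype.card_fin] at h3
    rw [Finset.disjoint_iff_inter_eq_empty, ← Finset.card_eq_zero]
    omega
  obtain ⟨x, y, hxy⟩ := exists_subset_pair_of_no_three (T := D.crossingPairs) (by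
    intro x hx y hy z hz
    by_contra! h
    have h1 := Finset.card_union_of_disjoint (disj x hx y hy h.1)
    have h2 := Finset.card_union_of_disjoint (Finset.disjoint_union_left.mpr
      ⟨disj x hx z hz h.2.1, disj y hy z hz h.2.2⟩)
    have h3 := Finset.card_le_univ (x.1 ∪ y.1 ∪ z.1)
    rw [Fintype.card_fin] at h3
    rw [h2, h1, (Drawing.card_of_mem_crossingPairs hx).1, (Drawing.card_of_mem_crossingPairs hy).1,
      (Drawing.card_of_mem_crossingPairs hz).1] at h3
    omega)
  have : ∀ S : Finset (Fin 5) × Finset (Fin 3), ∃ p, S.1.Nonempty → p ∈ S.1 := fun S => by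
    by_cases h : S.1.Nonempty
    · exact ⟨_, fun _ => h.choose_spec⟩
    · exact ⟨0, fun h' => absurd h' h⟩
  choose p hp using this
  obtain ⟨S, hS, hSA, -⟩ := D.exists_crossingPair (A := {p x, p y}ᶜ) (B := Finset.univ)
    (by rw [Finset.card_compl, Fintype.card_fin]; have := Finset.card_le_two (a := p x) (b := p y)
        omega) (by simp)
  have hpS := hp S (Finset.card_pos.mp (by rw [(Drawing.card_of_mem_crossingPairs hS).1]; simp))
  refine Finset.not_subset_of_mem_notMem hpS ?_ hSA
  rcases hxy hS with rfl | rfl <;> simp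

lemma Finset.eq_compl_of_card_two {S T : Finset (Fin 4)} (hS : S.card = 2) (hT : T.card = 2)
    (h : (S ∩ T).card = 0) : T = Sᶜ := by
  refine Finset.eq_of_subset_of_card_le ?_ (by simp [Finset.card_compl, hS, hT])
  rw [Finset.card_eq_zero, ← Finset.disjoint_iff_inter_eq_empty] at h
  exact Finset.subset_compl_iff_disjoint_left.mpr h

theorem not_nicPlanar_four_four : ¬ (completeBipartiteGraph (Fin 4) (Fin 4)).NICPlanar := by
  rintro ⟨D, hD⟩
  obtain ⟨x, y, hxy⟩ := exists_subset_pair_of_no_three (T := D.crossingPairs) (by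
    intro x hx y hy z hz
    by_contra! h
    have hxy := hD.card_inter_crossingPairs hx hy h.1
    have hxz := hD.card_inter_crossingPairs hx hz h.2.1
    have hyz := hD.card_inter_crossingPairs hy hz h.2.2
    obtain ⟨cx, cx'⟩ := Drawing.card_of_mem_crossingPairs hx
    obtain ⟨cy, cy'⟩ := Drawing.card_of_mem_crossingPairs hy
    obtain ⟨cz, cz'⟩ := Drawing.card_of_mem_crossingPairs hz
    have trans : ∀ {S T U : Finset (Fin 4)}, S.card = 2 → T.card = 2 → U.card = 2 →
        (S ∩ T).card = 0 → (S ∩ U).card = 0 → (T ∩ U).card = 2 := by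
      intro S T U cS cT cU h1 h2
      rw [Finset.eq_compl_of_card_two cS cU h2, Finset.eq_compl_of_card_two cS cT h1,
        Finset.inter_self, Finset.card_compl, cS, Fintype.card_fin]
    have t1 := trans cx cy cz
    have t2 := trans cy cx cz
    have t3 := trans cz cx cy
    have t1' := trans cx' cy' cz'
    have t2' := trans cy' cx' cz'
    have t3' := trans cz' cx' cy'
    simp only [Finset.inter_comm y.1 x.1, Finset.inter_comm z.1 x.1, Finset.inter_comm z.1 y.1,
      Finset.inter_comm y.2 x.2, Finset.inter_comm z.2 x.2, Finset.inter_comm z.2 y.2]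
      at t1 t2 t3 t1' t2' t3'
    omega)
  have : ∀ S : Finset (Fin 4), ∃ p, S.Nonempty → p ∈ S := fun S => by
    by_cases h : S.Nonempty
    · exact ⟨_, fun _ => h.choose_spec⟩
    · exact ⟨0, fun h' => absurd h' h⟩
  choose p hp using this
  obtain ⟨S, hS, hSA, hSB⟩ := D.exists_crossingPair (A := {p x.1}ᶜ) (B := {p y.2}ᶜ)
    (by simp [Finset.card_compl]) (by simp [Finset.card_compl])
  obtain ⟨c, c'⟩ := Drawing.card_of_mem_crossingPairs hS
  rcases hxy hS with rfl | rfl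
  · exact Finset.not_subset_of_mem_notMem (hp S.1 (Finset.card_pos.mp (by omega))) (by simp) hSA
  · exact Finset.not_subset_of_mem_notMem (hp S.2 (Finset.card_pos.mp (by omega))) (by simp) hSB

section straightLine

variable {α β : Type*}

/-- The embedding of the integer lattice into the plane. -/
def latticePoint (p : ℤ × ℤ) : ℝ × ℝ := (p.1, p.2)

lemma latticePoint_injective : Function.Injective latticePoint := fun p q h => by
  simpa [latticePoint, Prod.ext_iff] using h

lemma orient_latticePoint (p q r : ℤ × ℤ) :
    orient (latticePoint p) (latticePoint q) (latticePoint r) = (orient p q r : ℤ) := by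
  simp [orient, latticePoint]

/-- Numerical criterion for two independent edges to meet in the straight-line drawing of a complete
bipartite graph with lattice points as vertices. -/
def LatticeCross (P : α ⊕ β → ℤ × ℤ) (i : α) (j : β) (k : α) (l : β) : Prop :=
  i ≠ k ∧ j ≠ l ∧
    orient (P (.inl i)) (P (.inr j)) (P (.inl k)) *
      orient (P (.inl i)) (P (.inr j)) (P (.inr l)) ≤ 0 ∧
    orient (P (.inl k)) (P (.inr l)) (P (.inl i)) *
      orient (P (.inl k)) (P (.inr l)) (P (.inr j)) ≤ 0

instance [DecidableEq α] [DecidableEq β] (P : α ⊕ β → ℤ × ℤ) (i : α) (j : β) (k : α) (l : β) :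
    Decidable (LatticeCross P i j k l) := by
  unfold LatticeCross; infer_instance

/-- The segment from a vertex of the first part to a vertex of the second part. -/
def edgeSegment (P : α ⊕ β → ℤ × ℤ) (i : α) (j : β) : Set (ℝ × ℝ) :=
  segment ℝ (latticePoint (P (.inl i))) (latticePoint (P (.inr j)))

/-- The points `P` are distinct, and no edge of the complete bipartite graph is collinear with a
third vertex. -/
structure IsGeneral (P : α ⊕ β → ℤ × ℤ) : Prop where
  inj : Function.Injective P
  orient_ne : ∀ i j v, v ≠ .inl i → v ≠ .inr j → orient (P (.inl i)) (P (.inr j)) (P v) ≠ 0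

namespace IsGeneral

variable {P : α ⊕ β → ℤ × ℤ} (hP : IsGeneral P)
include hP

lemma orient_ne_real (i : α) (j : β) (v : α ⊕ β) (h₁ : v ≠ .inl i) (h₂ : v ≠ .inr j) :
    orient (latticePoint (P (.inl i))) (latticePoint (P (.inr j))) (latticePoint (P v)) ≠ 0 := by
  rw [orient_latticePoint]
  exact_mod_cast hP.orient_ne i j v h₁ h₂

lemma eq_or_eq_of_mem {i : α} {j : β} {v : α ⊕ β} (h : latticePoint (P v) ∈ edgeSegment P i j) :
    v = .inl i ∨ v = .inr j := by
  by_contra! hv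
  exact hP.orient_ne_real i j v hv.1 hv.2 (orient_eq_zero_of_mem_segment h)

lemma eq_of_mem_of_eq_left {i : α} {j l : β} (hjl : j ≠ l) {x : ℝ × ℝ}
    (hx : x ∈ edgeSegment P i j) (hx' : x ∈ edgeSegment P i l) :
    x = latticePoint (P (.inl i)) :=
  eq_of_mem_segment_of_mem_segment
    (hP.orient_ne_real i j (.inr l) (by simp) (by simpa using hjl.symm)) hx hx'

lemma eq_of_mem_of_eq_right {i k : α} {j : β} (hik : i ≠ k) {x : ℝ × ℝ}
    (hx : x ∈ edgeSegment P i j) (hx' : x ∈ edgeSegment P k j) :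
    x = latticePoint (P (.inr j)) := by
  rw [edgeSegment, segment_symm] at hx hx'
  refine eq_of_mem_segment_of_mem_segment ?_ hx hx'
  have := hP.orient_ne_real i j (.inl k) (by simpa using hik.symm) (by simp)
  contrapose! this
  rw [← neg_eq_zero, ← this]
  simp only [orient]; ring

lemma latticeCross_of_mem {i k : α} {j l : β} (hne : (i, j) ≠ (k, l)) {x : ℝ × ℝ}
    (hx : x ∈ edgeSegment P i j) (hx' : x ∈ edgeSegment P k l)
    (hpos : x ∉ range fun v => latticePoint (P v)) : LatticeCross P i j k l := by
  have hik : i ≠ k := by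
    rintro rfl
    exact hpos ⟨_, (hP.eq_of_mem_of_eq_left (by simpa using hne) hx hx').symm⟩
  have hjl : j ≠ l := by
    rintro rfl
    exact hpos ⟨_, (hP.eq_of_mem_of_eq_right hik hx hx').symm⟩
  have h1 := orient_mul_nonpos hx hx'
  have h2 := orient_mul_nonpos hx' hx
  simp only [orient_latticePoint] at h1 h2
  exact ⟨hik, hjl, by exact_mod_cast h1, by exact_mod_cast h2⟩

lemma eq_of_mem_of_mem {i k : α} {j l : β} (hne : (i, j) ≠ (k, l)) {x y : ℝ × ℝ}
    (hx : x ∈ edgeSegment P i j) (hx' : x ∈ edgeSegment P k l)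
    (hy : y ∈ edgeSegment P i j) (hy' : y ∈ edgeSegment P k l) : x = y := by
  by_cases hik : i = k
  · subst hik
    have hjl : j ≠ l := by simpa using hne
    rw [hP.eq_of_mem_of_eq_left hjl hx hx', hP.eq_of_mem_of_eq_left hjl hy hy']
  · exact segment_inter_subsingleton (hP.orient_ne_real i j (.inl k) (by simpa using Ne.symm hik)
      (by simp)) hx hx' hy hy'

end IsGeneral

/-- The parametrized segment representing an edge. -/
noncomputable def edgeArc (P : α ⊕ β → ℤ × ℤ) (e : (completeBipartiteGraph α β).edgeSet) (t : ℝ) :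
    ℝ × ℝ :=
  latticePoint (P (.inl (leftEnd e))) +
    t • (latticePoint (P (.inr (rightEnd e))) - latticePoint (P (.inl (leftEnd e))))

lemma edgeArc_image (P : α ⊕ β → ℤ × ℤ) (i : α) (j : β) :
    edgeArc P (bipartiteEdge i j) '' Icc 0 1 = edgeSegment P i j := by
  rw [edgeSegment, segment_eq_image']
  congr 1
  funext t
  simp only [leftEnd_bipartiteEdge, rightEnd_bipartiteEdge, edgeArc]

/-- The straight-line drawing of a complete bipartite graph with given lattice points as vertices,
provided that every edge crosses at most one other edge. -/
noncomputable def straightLineDrawing (P : α ⊕ β → ℤ × ℤ) (hP : IsGeneral P)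
    (huniq : ∀ i j k l k' l', LatticeCross P i j k l → LatticeCross P i j k' l' →
      k = k' ∧ l = l') : Drawing (completeBipartiteGraph α β) :=
  { pos := fun v => latticePoint (P v)
    pos_inj := latticePoint_injective.comp hP.inj
    arc := edgeArc P
    arc_cont := fun e => by unfold edgeArc; fun_prop
    arc_inj := fun e => by
      intro s _ t _ hst
      have hne : latticePoint (P (.inr (rightEnd e)))
          - latticePoint (P (.inl (leftEnd e))) ≠ 0 :=
        sub_ne_zero.mpr fun h => by simpa using (latticePoint_injective.comp hP.inj) h
      exact smul_left_injective ℝ hne (add_left_cancel hst)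
    arc_ends := fun e => ⟨.inl (leftEnd e), .inr (rightEnd e),
      congrArg Subtype.val (eq_bipartiteEdge e), by simp [edgeArc], by simp [edgeArc]⟩
    no_vertex_interior := fun e v hv hmem => by
      obtain ⟨i, j, rfl⟩ := exists_eq_bipartiteEdge e
      rw [edgeArc_image] at hmem
      exact hv (by simpa using hP.eq_or_eq_of_mem hmem)
    shared_endpoint := fun e₁ e₂ hne v h₁ h₂ x hx => by
      obtain ⟨i, j, rfl⟩ := exists_eq_bipartiteEdge e₁
      obtain ⟨k, l, rfl⟩ := exists_eq_bipartiteEdge e₂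
      rw [edgeArc_image, edgeArc_image] at hx
      rw [Ne, bipartiteEdge_inj] at hne
      simp only [coe_bipartiteEdge, Sym2.mem_iff] at h₁ h₂
      rcases h₁ with rfl | rfl
      · obtain rfl : i = k := by simpa using h₂
        exact hP.eq_of_mem_of_eq_left (by simpa using hne) hx.1 hx.2
      · obtain rfl : j = l := by simpa using h₂
        exact hP.eq_of_mem_of_eq_right (by simpa using hne) hx.1 hx.2
    finite_meet := fun e₁ e₂ hne => by
      obtain ⟨i, j, rfl⟩ := exists_eq_bipartiteEdge e₁
      obtain ⟨k, l, rfl⟩ := exists_eq_bipartiteEdge e₂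
      rw [edgeArc_image, edgeArc_image]
      rw [Ne, bipartiteEdge_inj, ← Prod.mk_inj] at hne
      exact Subsingleton.finite fun x hx y hy => hP.eq_of_mem_of_mem hne hx.1 hx.2 hy.1 hy.2
    proper := fun e₁ e₂ hne x hx hpos => by
      obtain ⟨i, j, rfl⟩ := exists_eq_bipartiteEdge e₁
      obtain ⟨k, l, rfl⟩ := exists_eq_bipartiteEdge e₂
      rw [edgeArc_image, edgeArc_image] at hx ⊢
      rw [Ne, bipartiteEdge_inj, ← Prod.mk_inj] at hne
      obtain ⟨hik, hjl, -⟩ := hP.latticeCross_of_mem hne hx.1 hx.2 hpos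
      exact properCross_segment
        (hP.orient_ne_real i j (.inl k) (by simpa using hik.symm) (by simp))
        (hP.orient_ne_real i j (.inr l) (by simp) (by simpa using hjl.symm))
        (hP.orient_ne_real k l (.inl i) (by simpa using hik) (by simp))
        (hP.orient_ne_real k l (.inr j) (by simp) (by simpa using hjl)) hx.1 hx.2
    at_most_two := fun x hpos e₁ e₂ e₃ h₁ h₂ h₃ => by
      obtain ⟨i, j, rfl⟩ := exists_eq_bipartiteEdge e₁
      obtain ⟨k, l, rfl⟩ := exists_eq_bipartiteEdge e₂
      obtain ⟨k', l', rfl⟩ := exists_eq_bipartiteEdge e₃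
      rw [edgeArc_image] at h₁ h₂ h₃
      simp only [bipartiteEdge_inj]
      by_contra! h
      obtain ⟨rfl, rfl⟩ := huniq i j k l k' l'
        (hP.latticeCross_of_mem (by simpa using h.1) h₁ h₂ hpos)
        (hP.latticeCross_of_mem (by simpa using h.2.1) h₁ h₃ hpos)
      exact h.2.2 rfl rfl }

lemma arcIm_straightLineDrawing (P : α ⊕ β → ℤ × ℤ) (hP : IsGeneral P)
    (huniq : ∀ i j k l k' l', LatticeCross P i j k l → LatticeCross P i j k' l' →
      k = k' ∧ l = l') (i : α) (j : β) :
    (straightLineDrawing P hP huniq).arcIm (bipartiteEdge i j) = edgeSegment P i j :=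
  edgeArc_image P i j

theorem nicPlanar_of_latticePoints [Finite α] [Finite β] [DecidableEq α] [DecidableEq β]
    (P : α ⊕ β → ℤ × ℤ) (hP : IsGeneral P)
    (huniq : ∀ i j k l k' l', LatticeCross P i j k l → LatticeCross P i j k' l' → k = k' ∧ l = l')
    (hnic : ∀ i j k l i' j' k' l', LatticeCross P i j k l → LatticeCross P i' j' k' l' →
      (i' = i ∧ j' = j) ∨ (i' = k ∧ j' = l) ∨
      (({.inl i, .inr j, .inl k, .inr l} ∩ {.inl i', .inr j', .inl k', .inr l'} :
        Finset (α ⊕ β))).card ≤ 1) :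
    (completeBipartiteGraph α β).NICPlanar := by
  have him := arcIm_straightLineDrawing P hP huniq
  set D := straightLineDrawing P hP huniq
  have hcross : ∀ {x i j k l}, x ∈ D.crossings → (i, j) ≠ (k, l) → x ∈ edgeSegment P i j →
      x ∈ edgeSegment P k l → LatticeCross P i j k l := fun hx hne h h' =>
    hP.latticeCross_of_mem hne h h' hx.1
  have partner : ∀ {x i j}, x ∈ D.crossings → x ∈ edgeSegment P i j →
      ∃ k l, (i, j) ≠ (k, l) ∧ x ∈ edgeSegment P k l := by
    rintro x i j ⟨-, e₁, e₂, hne, h₁, h₂⟩ hx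
    obtain ⟨a, b, rfl⟩ := exists_eq_bipartiteEdge e₁
    obtain ⟨c, d, rfl⟩ := exists_eq_bipartiteEdge e₂
    rw [him] at h₁ h₂
    rw [Ne, bipartiteEdge_inj, ← Prod.mk_inj] at hne
    by_cases h : (i, j) = (a, b)
    · exact ⟨c, d, h ▸ hne, h₂⟩
    · exact ⟨a, b, h, h₁⟩
  have one : ∀ {x y i j}, x ∈ D.crossings → y ∈ D.crossings → x ∈ edgeSegment P i j →
      y ∈ edgeSegment P i j → x = y := by
    intro x y i j hx hy h h'
    obtain ⟨k, l, hne, hkl⟩ := partner hx h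
    obtain ⟨k', l', hne', hkl'⟩ := partner hy h'
    obtain ⟨rfl, rfl⟩ := huniq _ _ _ _ _ _ (hcross hx hne h hkl) (hcross hy hne' h' hkl')
    exact hP.eq_of_mem_of_mem hne h hkl h' hkl'
  have cluster : ∀ {x i j k l}, x ∈ D.crossings → (i, j) ≠ (k, l) → x ∈ edgeSegment P i j →
      x ∈ edgeSegment P k l →
      D.cluster x ⊆ ({.inl i, .inr j, .inl k, .inr l} : Finset (α ⊕ β)) := by
    rintro x i j k l hx hne h h' v ⟨e, he, hv⟩
    obtain ⟨a, b, rfl⟩ := exists_eq_bipartiteEdge e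
    rw [← him] at h h'
    have := D.at_most_two x hx.1 _ _ _ h h' he
    simp only [bipartiteEdge_inj, coe_bipartiteEdge, Sym2.mem_iff, ← Prod.mk_inj] at this hv
    rcases this with h'' | h'' | h''
    · exact absurd h'' hne
    · obtain ⟨rfl, rfl⟩ := Prod.mk_inj.mp h''
      rcases hv with rfl | rfl <;> simp
    · obtain ⟨rfl, rfl⟩ := Prod.mk_inj.mp h''
      rcases hv with rfl | rfl <;> simp
  refine ⟨D, fun e x hx y hy => ?_, fun x hx y hy hxy => ?_⟩
  · obtain ⟨i, j, rfl⟩ := exists_eq_bipartiteEdge e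
    exact one hx.1 hy.1 (him i j ▸ hx.2) (him i j ▸ hy.2)
  · obtain ⟨-, e, -, -, he, -⟩ := id hx
    obtain ⟨-, e', -, -, he', -⟩ := id hy
    obtain ⟨i, j, rfl⟩ := exists_eq_bipartiteEdge e
    obtain ⟨i', j', rfl⟩ := exists_eq_bipartiteEdge e'
    rw [him] at he he'
    obtain ⟨k, l, hne, hkl⟩ := partner hx he
    obtain ⟨k', l', hne', hkl'⟩ := partner hy he'
    rcases hnic _ _ _ _ _ _ _ _ (hcross hx hne he hkl) (hcross hy hne' he' hkl')
      with ⟨rfl, rfl⟩ | ⟨rfl, rfl⟩ | h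
    · exact absurd (one hx hy he he') hxy
    · exact absurd (one hx hy hkl he') hxy
    · rw [← ncard_coe_finset, Finset.coe_inter] at h
      exact (ncard_le_ncard (inter_subset_inter (cluster hx hne he hkl)
        (cluster hy hne' he' hkl')) (toFinite _)).trans h

end straightLine

theorem nicPlanar_two (m : ℕ) : (completeBipartiteGraph (Fin m) (Fin 2)).NICPlanar := by
  let P : Fin m ⊕ Fin 2 → ℤ × ℤ := Sum.elim (fun i => ((i : ℤ) + 1, 0)) ![(0, 1), (0, -1)]
  have hno : ∀ i j k l, ¬ LatticeCross P i j k l := by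
    rintro i j k l ⟨hik, hjl, h1, h2⟩
    have hik' : (i : ℤ) ≠ k := fun h => hik (Fin.ext (by exact_mod_cast h))
    have hi : (0 : ℤ) ≤ i := by positivity
    have hk : (0 : ℤ) ≤ k := by positivity
    fin_cases j <;> fin_cases l <;> simp [P, orient] at hjl h1 h2 <;>
      rcases lt_or_gt_of_ne hik' with h | h <;> nlinarith
  refine nicPlanar_of_latticePoints P ⟨?_, ?_⟩ (fun i j k l k' l' h => absurd h (hno _ _ _ _))
    (fun i j k l i' j' k' l' h => absurd h (hno _ _ _ _))
  · refine Function.Injective.sumElim ?_ ?_ ?_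
    · intro i k h
      simpa [Fin.ext_iff] using h
    · decide
    · intro i j h
      have hi : (0 : ℤ) ≤ i := by positivity
      fin_cases j <;> simp at h
  · rintro i j (k | l) h1 h2
    · have hik : (k : ℤ) ≠ i := fun h =>
        h1 (congrArg Sum.inl (Fin.ext (by exact_mod_cast h)))
      fin_cases j <;> simp [P, orient] <;> omega
    · have hi : (0 : ℤ) ≤ i := by positivity
      fin_cases j <;> fin_cases l <;> simp [P, orient] at h2 ⊢ <;> omega

theorem nicPlanar_four_three : (completeBipartiteGraph (Fin 4) (Fin 3)).NICPlanar := by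
  let P : Fin 4 ⊕ Fin 3 → ℤ × ℤ :=
    Sum.elim ![(-2, 1), (1, 1), (-1, 0), (2, -2)] ![(0, 0), (0, -2), (1, 2)]
  have hcr : ∀ i j k l, LatticeCross P i j k l →
      (i, j, k, l) = (0, 0, 2, 2) ∨ (i, j, k, l) = (2, 2, 0, 0) ∨
      (i, j, k, l) = (1, 1, 3, 0) ∨ (i, j, k, l) = (3, 0, 1, 1) := by decide
  simp only [Prod.mk.injEq] at hcr
  refine nicPlanar_of_latticePoints P ⟨by decide, by decide⟩ ?_ ?_
  · intro i j k l k' l' h h'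
    have := hcr _ _ _ _ h
    have := hcr _ _ _ _ h'
    omega
  · intro i j k l i' j' k' l' h h'
    rcases hcr _ _ _ _ h with ⟨rfl, rfl, rfl, rfl⟩ | ⟨rfl, rfl, rfl, rfl⟩ |
        ⟨rfl, rfl, rfl, rfl⟩ | ⟨rfl, rfl, rfl, rfl⟩ <;>
      rcases hcr _ _ _ _ h' with ⟨rfl, rfl, rfl, rfl⟩ | ⟨rfl, rfl, rfl, rfl⟩ |
        ⟨rfl, rfl, rfl, rfl⟩ | ⟨rfl, rfl, rfl, rfl⟩ <;> decide

/-- for positive integers `m ≥ n`, the complete bipartite graph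
`K_{m,n}` is NIC-planar iff `n ≤ 2`, or `n = 3` and `m ≤ 4`. -/
theorem stmt5 (m n : ℕ) (hn : 0 < n) (hmn : n ≤ m) :
    (completeBipartiteGraph (Fin m) (Fin n)).NICPlanar ↔
      n ≤ 2 ∨ (n = 3 ∧ m ≤ 4) := by
  constructor
  · intro h
    by_contra! hcon
    rcases Nat.lt_or_ge n 4 with h4 | h4
    · exact not_nicPlanar_five_three (nicPlanar_completeBipartiteGraph_mono
        (show 5 ≤ m by have := hcon.2 (by omega); omega) (show 3 ≤ n by omega) h)
    · exact not_nicPlanar_four_four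
        (nicPlanar_completeBipartiteGraph_mono (show 4 ≤ m by omega) h4 h)
  · rintro (h | ⟨rfl, h⟩)
    · exact nicPlanar_completeBipartiteGraph_mono le_rfl h (nicPlanar_two m)
    · exact nicPlanar_completeBipartiteGraph_mono h le_rfl nicPlanar_four_three
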